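/- Let Ω ⊂ ℝ² be open and let u : Ω → ℝ be continuously differentiable and a weak solution of div(f'(‖∇u‖)∇u/‖∇u‖) = 0 in Ω. Suppose z₀ ∈ Ω and r > 0 are such that the closed ball B̄(z₀,r) ⊂ Ω, ∇u(z₀) = 0, and ∇u(z) ≠ 0 for every z ∈ B̄(z₀,r) \ {z₀}. Then the index of z₀ as a critical point of u is zero: for every 0 < s ≤ r and every continuous function θ : [0,2π] → ℝ satisfying ∇u(z₀ + s·e(t))/‖∇u(z₀ + s·e(t))‖ = (cos θ(t), sin θ(t)) for all t ∈ [0,2π], where e(t) = (cos t, sin t), one has θ(2π) = θ(0). -/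

import Mathlib

open Set MeasureTheory Metric Filter
open scoped RealInnerProductSpace Topology Classical

noncomputable section

abbrev E2 := EuclideanSpace ℝ (Fin 2)

/-- A function is Lipschitz on a set (with some constant). -/
def LipOn (w : E2 → ℝ) (s : Set E2) : Prop := ∃ L : NNReal, LipschitzOnWith L w s

/-- The functional `J(w) = ∫_Ω f(‖∇w‖)`, with `∇w` the a.e.-defined (Rademacher) gradient,
extended by the junk value `0` where `w` is not differentiable. -/
def J (f : ℝ → ℝ) (Ω : Set E2) (w : E2 → ℝ) : ℝ := ∫ x in Ω, f ‖gradient w x‖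

/-- The (one-sided at `0`) derivative of `f` on `[0,∞)`. -/
def dtop (f : ℝ → ℝ) : ℝ → ℝ := derivWithin f (Set.Ici 0)

/-- Standing assumptions on the Lagrangian `f` : strictly convex on `[0,∞)`, `C¹` on `[0,∞)`,
`C²` on `(0,∞)` with `f''` locally Hölder continuous of some exponent `λ ∈ (0,1)`,
and `f'(0) > 0`. -/
def StdF (f : ℝ → ℝ) : Prop :=
  StrictConvexOn ℝ (Set.Ici 0) f ∧ ContDiffOn ℝ 1 f (Set.Ici 0) ∧
  ContDiffOn ℝ 2 f (Set.Ioi 0) ∧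
  (∃ lam : NNReal, 0 < lam ∧ lam < 1 ∧ ∀ K : Set ℝ, IsCompact K → K ⊆ Set.Ioi 0 →
    ∃ C : NNReal, HolderOnWith C lam (deriv (dtop f)) K) ∧
  0 < dtop f 0

/-- `u` solves the variational problem (P): `u` is Lipschitz on the closure of `Ω`,
`u = ψ` on `∂Ω`, and `u` minimizes `J` among such functions. -/
def SolvesP (f : ℝ → ℝ) (Ω : Set E2) (ψ : E2 → ℝ) (u : E2 → ℝ) : Prop :=
  LipOn u (closure Ω) ∧ EqOn u ψ (frontier Ω) ∧
  ∀ w : E2 → ℝ, LipOn w (closure Ω) → EqOn w ψ (frontier Ω) → J f Ω u ≤ J f Ω w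

/-- `u` has an isolated critical point in `Ω`. -/
def HasIsolatedCritPt (Ω : Set E2) (u : E2 → ℝ) : Prop :=
  ∃ z₀ ∈ Ω, ∃ r > (0:ℝ), gradient u z₀ = 0 ∧
    ∀ z ∈ Ω, z ≠ z₀ → dist z z₀ < r → gradient u z ≠ 0

/-- `u` is a weak solution of `div(f'(‖∇u‖)∇u/‖∇u‖) = 0` in `Ω`: the integral identity holds
against every smooth test function compactly supported in `Ω`, the integrand being `0` at
critical points of `u`. -/
def WeakSol (f' : ℝ → ℝ) (Ω : Set E2) (u : E2 → ℝ) : Prop :=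
  ∀ φ : E2 → ℝ, ContDiff ℝ (⊤ : ℕ∞) φ → HasCompactSupport φ → tsupport φ ⊆ Ω →
    (∫ z in Ω, (if gradient u z = 0 then 0 else
      f' ‖gradient u z‖ * ⟪(‖gradient u z‖)⁻¹ • gradient u z, gradient φ z⟫)) = 0

/-- The unit vector `e(t) = (cos t, sin t)` in the plane. -/
def eVec (t : ℝ) : E2 := (WithLp.equiv 2 (Fin 2 → ℝ)).symm ![Real.cos t, Real.sin t]

theorem HasGradientAt.norm_le_of_eventually_le {v : E2 → ℝ} {g x : E2} {k : ℝ}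
    (hv : HasGradientAt v g x) (hle : ∀ᶠ y in 𝓝 x, v y ≤ v x + k * ‖y - x‖) : ‖g‖ ≤ k := by
  by_contra! hk
  have hε : 0 < (‖g‖ - k) / 2 := by linarith
  have h1 := (hasFDerivAt_iff_isLittleO.1 hv.hasFDerivAt).def hε
  have hg : 0 < ‖g‖ := by
    by_contra! h0
    have hg0 : g = 0 := norm_le_zero_iff.1 h0
    subst hg0
    have h2 := (h1.and hle)
    simp only [norm_zero] at hk hε h2
    have hc : Tendsto (fun t : ℝ => x + t • (EuclideanSpace.single 0 1 : E2)) (𝓝[>] 0) (𝓝 x) := by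
      have : Continuous fun t : ℝ => x + t • (EuclideanSpace.single 0 1 : E2) := by fun_prop
      simpa using (this.tendsto 0).mono_left nhdsWithin_le_nhds
    obtain ⟨t, ht, ht0⟩ := ((hc.eventually h2).and self_mem_nhdsWithin).exists
    have ht0 : 0 < t := ht0
    obtain ⟨ha, hb⟩ := ht
    simp [norm_smul, abs_of_pos ht0] at ha hb
    have := neg_abs_le (v (x + t • (EuclideanSpace.single 0 1 : E2)) - v x)
    nlinarith
  have hc : Tendsto (fun t : ℝ => x + t • g) (𝓝[>] 0) (𝓝 x) := by
    have : Continuous fun t : ℝ => x + t • g := by fun_prop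
    simpa using (this.tendsto 0).mono_left nhdsWithin_le_nhds
  obtain ⟨t, ht, ht0⟩ := ((hc.eventually (h1.and hle)).and self_mem_nhdsWithin).exists
  have ht0 : 0 < t := ht0
  obtain ⟨ha, hb⟩ := ht
  simp [norm_smul, abs_of_pos ht0] at ha hb
  have := neg_abs_le (v (x + t • g) - v x - t * ‖g‖ ^ 2)
  have h3 : t * ‖g‖ ^ 2 ≤ k * (t * ‖g‖) + (‖g‖ - k) / 2 * (t * ‖g‖) := by linarith
  have h4 : 0 < t * ‖g‖ := by positivity
  nlinarith

/-- If `x` maximizes `v - k‖· - p‖` on a closed ball around `p`, then either `v` grows by `k R`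
from `p` to the boundary point `x`, or `x` is interior and `v` has slope at most `k` there. -/
theorem exists_growth_or_slope_le {v : E2 → ℝ} {p : E2} {R k : ℝ} (hR : 0 ≤ R) (hk : 0 ≤ k)
    (hv : ContinuousOn v (closedBall p R)) :
    ∃ x ∈ closedBall p R, v p + k * ‖x - p‖ ≤ v x ∧
      (v p + k * R ≤ v x ∨ (x ∈ ball p R ∧ ∀ᶠ y in 𝓝 x, v y ≤ v x + k * ‖y - x‖)) := by
  obtain ⟨x, hx, hmax⟩ := (isCompact_closedBall p R).exists_isMaxOn
    (nonempty_closedBall.2 hR) (f := fun x => v x - k * ‖x - p‖) (by fun_prop)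
  have hp : v p + k * ‖x - p‖ ≤ v x := by
    have := hmax (mem_closedBall_self hR)
    simp at this
    linarith
  refine ⟨x, hx, hp, ?_⟩
  rcases (mem_closedBall.1 hx).lt_or_eq with h | h
  · right
    refine ⟨h, ?_⟩
    filter_upwards [isOpen_ball.mem_nhds h] with y hy
    have h1 := hmax (ball_subset_closedBall hy)
    simp only [mem_ofPred_eq] at h1
    have h2 : ‖y - p‖ ≤ ‖y - x‖ + ‖x - p‖ := by
      simpa using norm_add_le (y - x) (x - p)
    nlinarith
  · left
    rw [dist_eq_norm] at h
    rwa [h] at hp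

section Growth

variable {v : E2 → ℝ} {G : E2 → E2} {z₀ : E2} {ρ c : ℝ}

theorem not_eventually_le_of_not_isLocalMax (hc : ContinuousOn v (ball z₀ ρ)) (hρ : 0 < ρ)
    (hG : ∀ x ∈ ball z₀ ρ, x ≠ z₀ → HasGradientAt v (G x) x)
    (hcG : ∀ x ∈ ball z₀ ρ, x ≠ z₀ → c ≤ ‖G x‖) (hmax : ¬ IsLocalMax v z₀)
    {k : ℝ} (hk : 0 ≤ k) (hkc : k < c) :
    ¬ ∀ᶠ y in 𝓝 z₀, v y ≤ v z₀ + k * ‖y - z₀‖ := by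
  intro hev
  obtain ⟨r₁, hr₁, hb⟩ := Metric.eventually_nhds_iff_ball.1 hev
  set k' := (k + c) / 2 with hk'
  set R := min r₁ ρ / 3 with hR
  have hR0 : 0 < R := by positivity
  have hRr : 3 * R ≤ r₁ := by have := min_le_left r₁ ρ; linarith
  have hRρ : 3 * R ≤ ρ := by have := min_le_right r₁ ρ; linarith
  have hkk : 0 < k' - k := by linarith
  have hδ : 0 < min R ((k' - k) * R / (k + 1)) := by positivity
  have : ∃ q ∈ ball z₀ (min R ((k' - k) * R / (k + 1))), v z₀ < v q := by
    by_contra! hq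
    exact hmax (Metric.eventually_nhds_iff_ball.2 ⟨_, hδ, hq⟩)
  obtain ⟨q, hq, hvq⟩ := this
  have hq1 : ‖q - z₀‖ < R := by
    rw [← dist_eq_norm]; exact (mem_ball.1 hq).trans_le (min_le_left _ _)
  have hq2 : ‖q - z₀‖ * (k + 1) < (k' - k) * R := by
    rw [← lt_div_iff₀ (by linarith), ← dist_eq_norm]
    exact (mem_ball.1 hq).trans_le (min_le_right _ _)
  have hsub : ∀ x ∈ closedBall q R, ‖x - z₀‖ ≤ R + ‖q - z₀‖ := by
    intro x hx
    rw [mem_closedBall, dist_eq_norm] at hx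
    have : ‖x - z₀‖ ≤ ‖x - q‖ + ‖q - z₀‖ := by simpa using norm_add_le (x - q) (q - z₀)
    linarith
  have hsubρ : closedBall q R ⊆ ball z₀ ρ := by
    intro x hx
    rw [mem_ball, dist_eq_norm]
    linarith [hsub x hx]
  obtain ⟨x, hx, hx1, hx2⟩ := exists_growth_or_slope_le hR0.le (by linarith : 0 ≤ k')
    (hc.mono hsubρ)
  rcases hx2 with h | ⟨-, h⟩
  · have h1 := hb x (by rw [mem_ball, dist_eq_norm]; linarith [hsub x hx])
    nlinarith [hsub x hx, norm_nonneg (q - z₀)]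
  · have hxz : x ≠ z₀ := by
      rintro rfl
      nlinarith [norm_nonneg (x - q)]
    have := (hG x (hsubρ hx) hxz).norm_le_of_eventually_le h
    linarith [hcG x (hsubρ hx) hxz]

theorem exists_growth (hc : ContinuousOn v (ball z₀ ρ)) (hρ : 0 < ρ)
    (hG : ∀ x ∈ ball z₀ ρ, x ≠ z₀ → HasGradientAt v (G x) x)
    (hcG : ∀ x ∈ ball z₀ ρ, x ≠ z₀ → c ≤ ‖G x‖) (hmax : ¬ IsLocalMax v z₀)
    {k : ℝ} (hk : 0 ≤ k) (hkc : k < c) {p : E2} {R : ℝ} (hR : 0 ≤ R)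
    (hsub : closedBall p R ⊆ ball z₀ ρ) :
    ∃ x ∈ closedBall p R, v p + k * R ≤ v x := by
  obtain ⟨x, hx, -, h | ⟨-, h⟩⟩ := exists_growth_or_slope_le hR hk (hc.mono hsub)
  · exact ⟨x, hx, h⟩
  · by_cases hxz : x = z₀
    · subst hxz
      exact absurd h (not_eventually_le_of_not_isLocalMax hc hρ hG hcG hmax hk hkc)
    · have := (hG x (hsub hx) hxz).norm_le_of_eventually_le h
      linarith [hcG x (hsub hx) hxz]

end Growth

theorem norm_sub_le_of_norm_le {w a : E2} {R : ℝ} (hR : 0 < R) (ha : ‖a‖ ≤ R) :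
    ‖w - a‖ ≤ R - ⟪w, a⟫ / R + ‖w‖ ^ 2 / (2 * R) := by
  have h1 : ‖w - a‖ ^ 2 = ‖w‖ ^ 2 - 2 * ⟪w, a⟫ + ‖a‖ ^ 2 := norm_sub_sq_real w a
  have h2 : ‖a‖ ^ 2 ≤ R ^ 2 := by gcongr
  have h3 : R - ⟪w, a⟫ / R + ‖w‖ ^ 2 / (2 * R) = (2 * R ^ 2 - 2 * ⟪w, a⟫ + ‖w‖ ^ 2) / (2 * R) := by
    field_simp
  rw [h3, le_div_iff₀ (by positivity)]
  nlinarith [sq_nonneg (‖w - a‖ - R)]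

/-- Symmetric differences of a Lipschitz function that has nearly maximal growth and decay on a
ball around `p` are close to those of a linear function. -/
theorem lower_bound_symm_diff {v : E2 → ℝ} {p a b w : E2} {R L k : ℝ} (hR : 0 < R) (hL : 0 ≤ L)
    (ha : ‖a‖ ≤ R) (hb : ‖b‖ ≤ R) (hva : v p + k * R ≤ v (p + a)) (hvb : v (p + b) ≤ v p - k * R)
    (h1 : |v (p + w) - v (p + a)| ≤ L * ‖w - a‖) (h2 : |v (p - w) - v (p + b)| ≤ L * ‖-w - b‖) :
    L * ⟪w, a - b⟫ / R - 2 * (L - k) * R - L * ‖w‖ ^ 2 / R ≤ v (p + w) - v (p - w) := by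
  have e1 := mul_le_mul_of_nonneg_left (norm_sub_le_of_norm_le (w := w) hR ha) hL
  have e2 := mul_le_mul_of_nonneg_left (norm_sub_le_of_norm_le (w := -w) hR hb) hL
  rw [abs_le] at h1 h2
  rw [inner_neg_left, norm_neg] at e2
  have e3 : L * ⟪w, a - b⟫ / R - 2 * (L - k) * R - L * ‖w‖ ^ 2 / R =
      2 * k * R - L * (R - ⟪w, a⟫ / R + ‖w‖ ^ 2 / (2 * R))
        - L * (R - -⟪w, b⟫ / R + ‖w‖ ^ 2 / (2 * R)) := by
    rw [inner_sub_right]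
    field_simp
    ring
  linarith [h1.1, h2.2]

/-- The symmetric differences of `v` in the two coordinate directions cannot both vanish if `v` is
nearly a solution of the eikonal equation without local extremum at `z₀`. -/
theorem not_forall_symm_diff_eq_zero {v : E2 → ℝ} {G : E2 → E2} {z₀ p : E2} {ρ c τ : ℝ}
    (hc : ContinuousOn v (ball z₀ ρ)) (hρ : 0 < ρ)
    (hG : ∀ x ∈ ball z₀ ρ, x ≠ z₀ → HasGradientAt v (G x) x)
    (hcG : ∀ x ∈ ball z₀ ρ, x ≠ z₀ → c ≤ ‖G x‖) (hc0 : 0 < c)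
    (hLip : ∀ x ∈ ball z₀ ρ, ∀ y ∈ ball z₀ ρ, |v x - v y| ≤ 17 / 16 * c * ‖x - y‖)
    (hmax : ¬ IsLocalMax v z₀) (hmin : ¬ IsLocalMin v z₀)
    (hτ : 0 < τ) (hsub : closedBall p (2 * τ) ⊆ ball z₀ ρ) :
    ¬ ∀ i, v (p + τ • EuclideanSpace.single i 1) - v (p - τ • EuclideanSpace.single i 1) = 0 := by
  intro hzero
  have hR : 0 < 2 * τ := by positivity
  obtain ⟨x, hx, hvx⟩ := exists_growth (k := 15 / 16 * c) hc hρ hG hcG hmax (by positivity)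
    (by linarith) hR.le hsub
  obtain ⟨y, hy, hvy⟩ := exists_growth (v := fun x => -v x) (G := fun x => -G x)
    (k := 15 / 16 * c) hc.neg hρ
    (fun x hx hxz => by
      have := (hG x hx hxz).hasFDerivAt.neg
      rw [← map_neg] at this
      exact this)
    (fun x hx hxz => by rw [norm_neg]; exact hcG x hx hxz)
    (fun h => hmin (by simpa using h.neg)) (by positivity) (by linarith) hR.le hsub
  obtain ⟨a, rfl⟩ : ∃ a, x = p + a := ⟨x - p, by simp⟩
  obtain ⟨b, rfl⟩ : ∃ b, y = p + b := ⟨y - p, by simp⟩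
  have ha : ‖a‖ ≤ 2 * τ := by simpa using hx
  have hb : ‖b‖ ≤ 2 * τ := by simpa using hy
  have hLw : ∀ w : E2, ‖w‖ = τ →
      17 / 16 * c * ⟪w, a - b⟫ / (2 * τ) - 2 * (17 / 16 * c - 15 / 16 * c) * (2 * τ)
        - 17 / 16 * c * ‖w‖ ^ 2 / (2 * τ) ≤ v (p + w) - v (p - w) := by
    intro w hw
    have hpw : p + w ∈ ball z₀ ρ :=
      hsub (by simp only [mem_closedBall, dist_self_add_left, hw]; linarith)
    have hpw' : p - w ∈ ball z₀ ρ :=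
      hsub (by simp only [mem_closedBall, dist_self_sub_left, hw]; linarith)
    refine lower_bound_symm_diff hR (by positivity) ha hb hvx (by linarith) ?_ ?_
    · simpa using hLip _ hpw _ (hsub hx)
    · have := hLip _ hpw' _ (hsub hy)
      rwa [show p - w - (p + b) = -w - b by abel] at this
  have key : ∀ i, |(a - b) i| ≤ 33 / 17 * τ := by
    intro i
    have hn : ‖τ • (EuclideanSpace.single i 1 : E2)‖ = τ := by simp [norm_smul, hτ.le]
    have h1 := hLw (τ • EuclideanSpace.single i 1) hn
    have h2 := hLw (-(τ • EuclideanSpace.single i 1)) (by rw [norm_neg, hn])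
    have h0 := hzero i
    have hin : ⟪τ • (EuclideanSpace.single i 1 : E2), a - b⟫ = τ * (a - b) i := by
      rw [real_inner_smul_left, EuclideanSpace.inner_single_left]
      simp
    rw [hn, hin, h0] at h1
    rw [norm_neg, hn, inner_neg_left, hin, ← sub_eq_add_neg, sub_neg_eq_add] at h2
    set d := (a - b) i
    have e1 : 17 / 16 * c * (τ * d) / (2 * τ) = 17 / 32 * c * d := by field_simp; ring
    have e2 : 17 / 16 * c * -(τ * d) / (2 * τ) = -(17 / 32 * c * d) := by field_simp; ring
    have e3 : 17 / 16 * c * τ ^ 2 / (2 * τ) = 17 / 32 * c * τ := by field_simp; ring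
    rw [e1, e3] at h1
    rw [e2, e3] at h2
    rw [abs_le]
    constructor
    · by_contra! hd
      nlinarith
    · by_contra! hd
      nlinarith
  have hlow : 15 / 4 * τ ≤ 17 / 16 * ‖a - b‖ := by
    have h1 := (le_abs_self _).trans (hLip _ (hsub hx) _ (hsub hy))
    rw [add_sub_add_left_eq_sub] at h1
    have h2 : c * (15 / 4 * τ) ≤ c * (17 / 16 * ‖a - b‖) := by linarith
    exact le_of_mul_le_mul_left h2 hc0
  have hsq : ‖a - b‖ ^ 2 = (a - b) 0 ^ 2 + (a - b) 1 ^ 2 := by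
    rw [EuclideanSpace.norm_sq_eq]
    simp [Fin.sum_univ_two]
  have k0 := sq_le_sq' (abs_le.1 (key 0)).1 (abs_le.1 (key 0)).2
  have k1 := sq_le_sq' (abs_le.1 (key 1)).1 (abs_le.1 (key 1)).2
  nlinarith

theorem continuousAt_symm_diff_quotient {v τ : E2 → ℝ} {G : E2 → E2} {p : E2}
    (hv : HasStrictFDerivAt v (InnerProductSpace.toDual ℝ E2 (G p)) p) (hG : ContinuousAt G p)
    (hτ : ContinuousAt τ p) (hτ0 : τ p = 0) (i : Fin 2) :
    ContinuousAt (fun q => if τ q = 0 then G q i else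
      (v (q + τ q • EuclideanSpace.single i 1) - v (q - τ q • EuclideanSpace.single i 1))
        / (2 * τ q)) p := by
  rw [Metric.continuousAt_iff']
  intro ε hε
  have hlim : Tendsto (fun q => (q + τ q • (EuclideanSpace.single i 1 : E2),
      q - τ q • (EuclideanSpace.single i 1 : E2))) (𝓝 p) (𝓝 (p, p)) := by
    have : ContinuousAt (fun q => (q + τ q • (EuclideanSpace.single i 1 : E2),
      q - τ q • (EuclideanSpace.single i 1 : E2))) p := by fun_prop
    simpa [ContinuousAt, hτ0] using this
  have h1 := hlim.eventually (hv.isLittleO.def (half_pos hε))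
  have hGi : ContinuousAt (fun q => G q i) p := by fun_prop
  filter_upwards [h1, Metric.continuousAt_iff'.1 hGi ε hε] with q hq hq2
  simp only [hτ0, if_true]
  split_ifs with h
  · exact hq2
  · have e : q + τ q • (EuclideanSpace.single i 1 : E2) - (q - τ q • EuclideanSpace.single i 1)
        = (2 * τ q) • EuclideanSpace.single i 1 := by module
    have h2 : 0 < |2 * τ q| := by positivity
    simp only [e, InnerProductSpace.toDual_apply_apply, real_inner_smul_right, norm_smul,
      EuclideanSpace.inner_single_right, Real.norm_eq_abs] at hq
    simp only [PiLp.norm_single, norm_one, mul_one, one_mul, conj_trivial] at hq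
    rw [Real.dist_eq]
    have e2 : (v (q + τ q • EuclideanSpace.single i 1) - v (q - τ q • EuclideanSpace.single i 1))
        / (2 * τ q) - G p i = (v (q + τ q • EuclideanSpace.single i 1)
          - v (q - τ q • EuclideanSpace.single i 1) - 2 * τ q * G p i) / (2 * τ q) := by
      field_simp
    rw [e2, abs_div, div_lt_iff₀ h2]
    nlinarith

theorem eVec_apply_zero (t : ℝ) : eVec t 0 = Real.cos t := rfl

theorem eVec_apply_one (t : ℝ) : eVec t 1 = Real.sin t := rfl

theorem norm_eVec (t : ℝ) : ‖eVec t‖ = 1 := by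
  rw [EuclideanSpace.norm_eq, Fin.sum_univ_two, eVec_apply_zero, eVec_apply_one]
  simp

theorem continuous_eVec : Continuous eVec := by
  have h : Continuous fun t : ℝ => (![Real.cos t, Real.sin t] : Fin 2 → ℝ) := by
    refine continuous_pi fun i => ?_
    fin_cases i
    · exact Real.continuous_cos
    · exact Real.continuous_sin
  exact (PiLp.continuous_toLp 2 _).comp h

/-- A nowhere vanishing continuous complex function on a closed disc has winding number zero along
the boundary circle. -/
theorem angle_eq_of_continuousOn_closedBall {P : E2 → ℂ} {z₀ : E2} {s : ℝ} (hs : 0 < s)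
    (hP : ContinuousOn P (closedBall z₀ s)) (hP0 : ∀ q ∈ closedBall z₀ s, P q ≠ 0)
    {θ m : ℝ → ℝ} (hθ : ContinuousOn θ (Icc 0 (2 * Real.pi)))
    (hm : ∀ t ∈ Icc 0 (2 * Real.pi), 0 < m t)
    (h : ∀ t ∈ Icc 0 (2 * Real.pi), P (z₀ + s • eVec t) = m t * Complex.exp (θ t * Complex.I)) :
    θ (2 * Real.pi) = θ 0 := by
  set ret : E2 → E2 := fun x => z₀ + (s / max s ‖x - z₀‖) • (x - z₀) with hret
  have hmax : ∀ x, 0 < max s ‖x - z₀‖ := fun x => hs.trans_le (le_max_left _ _)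
  have hretc : Continuous ret := by
    have : Continuous fun x => s / max s ‖x - z₀‖ :=
      continuous_const.div (by fun_prop) fun x => (hmax x).ne'
    fun_prop
  have hretm : ∀ x, ret x ∈ closedBall z₀ s := by
    intro x
    rw [mem_closedBall, dist_eq_norm, hret]
    simp only [add_sub_cancel_left, norm_smul, Real.norm_eq_abs, abs_div, abs_of_pos hs,
      abs_of_pos (hmax x)]
    rw [div_mul_eq_mul_div, div_le_iff₀ (hmax x)]
    gcongr
    exact le_max_right _ _
  have hret1 : ∀ t, ret (z₀ + s • eVec t) = z₀ + s • eVec t := by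
    intro t
    simp [hret, norm_smul, norm_eVec, abs_of_pos hs, hs.ne']
  have hQc : Continuous fun x => P (ret x) := hP.comp_continuous hretc hretm
  have hQ0 : ∀ x, P (ret x) ≠ 0 := fun x => hP0 _ (hretm x)
  have hNc : Continuous fun x => P (ret x) / (‖P (ret x)‖ : ℂ) :=
    hQc.div (Complex.continuous_ofReal.comp hQc.norm) fun x => by simpa using hQ0 x
  have hN1 : ∀ x, P (ret x) / (‖P (ret x)‖ : ℂ) ∈ Submonoid.unitSphere ℂ := by
    intro x
    change _ ∈ sphere (0 : ℂ) 1
    simp [hQ0 x]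
  let F : C(E2, Circle) := ⟨fun x => ⟨P (ret x) / (‖P (ret x)‖ : ℂ), hN1 x⟩, hNc.subtype_mk hN1⟩
  obtain ⟨e₀, he₀⟩ : ∃ e, Circle.exp e = F z₀ := ⟨_, Circle.exp_arg (F z₀)⟩
  obtain ⟨Θ, ⟨-, hΘ⟩, -⟩ := Circle.isCoveringMap_exp.existsUnique_continuousMap_lifts F z₀ e₀ he₀
  have hdiff : ∀ t ∈ Icc 0 (2 * Real.pi),
      (θ t - Θ (z₀ + s • eVec t)) / (2 * Real.pi) ∈ range ((↑) : ℤ → ℝ) := by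
    intro t ht
    have h1 : Circle.exp (Θ (z₀ + s • eVec t)) = F (z₀ + s • eVec t) := congrFun hΘ _
    have h2 : Circle.exp (θ t) = F (z₀ + s • eVec t) := by
      apply Circle.coe_injective
      change _ = P (ret (z₀ + s • eVec t)) / (‖P (ret (z₀ + s • eVec t))‖ : ℂ)
      have hmt := hm t ht
      rw [hret1, h t ht, Circle.coe_exp, norm_mul, Complex.norm_exp_ofReal_mul_I]
      simp [abs_of_pos hmt, hmt.ne']
    obtain ⟨n, hn⟩ := Circle.exp_eq_exp.1 (h2.trans h1.symm)
    refine ⟨n, ?_⟩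
    rw [hn]
    field_simp
    ring
  have hΘc : Continuous fun t => Θ (z₀ + s • eVec t) :=
    Θ.continuous.comp (continuous_const.add (continuous_eVec.const_smul s))
  have hpi : (0 : ℝ) ≤ 2 * Real.pi := by positivity
  have := isPreconnected_Icc.constant_of_mapsTo (T := range ((↑) : ℤ → ℝ))
    Int.isClosedEmbedding_coe_real.isInducing.isDiscrete_range
    (f := fun t => (θ t - Θ (z₀ + s • eVec t)) / (2 * Real.pi))
    ((hθ.sub hΘc.continuousOn).div_const _) hdiff (right_mem_Icc.2 hpi) (left_mem_Icc.2 hpi)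
  have he : eVec (2 * Real.pi) = eVec 0 := by
    ext i
    fin_cases i
    · change Real.cos _ = Real.cos _; simp
    · change Real.sin _ = Real.sin _; simp
  rw [he] at this
  field_simp at this
  linarith

/-- If the gradients of `u` and `v` are linearly independent away from `z₀`, then `v` has no local
maximum at `z₀`: it would be strict, and `u` restricted to a nearby compact level curve of `v`
would have a constrained critical point. -/
theorem not_isLocalMax_of_independent_gradients {u v : E2 → ℝ} {A G : E2 → E2} {z₀ : E2} {ρ : ℝ}
    (hρ : 0 < ρ) (hvc : ContinuousOn v (ball z₀ ρ))
    (hu : ∀ x ∈ ball z₀ ρ, x ≠ z₀ →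
      HasStrictFDerivAt u (InnerProductSpace.toDual ℝ E2 (A x)) x)
    (hv : ∀ x ∈ ball z₀ ρ, x ≠ z₀ →
      HasStrictFDerivAt v (InnerProductSpace.toDual ℝ E2 (G x)) x)
    (hind : ∀ x ∈ ball z₀ ρ, x ≠ z₀ → ∀ α β : ℝ, α • G x + β • A x = 0 → α = 0 ∧ β = 0) :
    ¬ IsLocalMax v z₀ := by
  intro hmax
  obtain ⟨δ, hδ, hle⟩ := Metric.eventually_nhds_iff_ball.1 hmax
  set η := min δ ρ / 2 with hη
  have hη0 : 0 < η := by positivity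
  have hsub : closedBall z₀ η ⊆ ball z₀ (min δ ρ) :=
    closedBall_subset_ball (by have : 0 < min δ ρ := by positivity
                               linarith)
  have hsubρ : closedBall z₀ η ⊆ ball z₀ ρ := hsub.trans (ball_subset_ball (min_le_right _ _))
  have hsubδ : closedBall z₀ η ⊆ ball z₀ δ := hsub.trans (ball_subset_ball (min_le_left _ _))
  have hlt : ∀ y ∈ closedBall z₀ η, y ≠ z₀ → v y < v z₀ := by
    intro y hy hyz
    refine (hle y (hsubδ hy)).lt_of_ne fun heq => ?_
    have hloc : IsLocalMax v y := by
      filter_upwards [isOpen_ball.mem_nhds (hsubδ hy)] with x hx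
      rw [heq]
      exact hle x hx
    have h0 := hloc.hasFDerivAt_eq_zero (hv y (hsubρ hy) hyz).hasFDerivAt
    have hG0 : G y = 0 := by simpa using h0
    have := (hind y (hsubρ hy) hyz 1 0 (by simp [hG0])).1
    norm_num at this
  obtain ⟨x₁, hx₁, hx₁max⟩ := (isCompact_sphere z₀ η).exists_isMaxOn
    ((NormedSpace.sphere_nonempty (x := z₀)).2 hη0.le)
    (hvc.mono (sphere_subset_closedBall.trans hsubρ))
  have hx₁z : x₁ ≠ z₀ := by
    rintro rfl
    simp at hx₁
    linarith
  have hM := hlt x₁ (sphere_subset_closedBall hx₁) hx₁z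
  obtain ⟨a, ha1, ha2⟩ := exists_between hM
  have hK : IsCompact (closedBall z₀ η ∩ v ⁻¹' {a}) :=
    (isCompact_closedBall z₀ η).of_isClosed_subset
      ((hvc.mono hsubρ).preimage_isClosed_of_isClosed isClosed_closedBall isClosed_singleton)
      inter_subset_left
  have hKne : (closedBall z₀ η ∩ v ⁻¹' {a}).Nonempty := by
    obtain ⟨x, hx, hxa⟩ := (convex_closedBall z₀ η).isPreconnected.intermediate_value
      (sphere_subset_closedBall hx₁) (mem_closedBall_self hη0.le) (hvc.mono hsubρ)
      ⟨ha1.le, ha2.le⟩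
    exact ⟨x, hx, hxa⟩
  have hKz : ∀ x ∈ closedBall z₀ η ∩ v ⁻¹' {a}, x ≠ z₀ := by
    rintro x ⟨-, hx⟩ rfl
    exact ha2.ne' hx
  obtain ⟨x, hx, hxmax⟩ := hK.exists_isMaxOn hKne (f := u) fun x hx =>
    (hu x (hsubρ hx.1) (hKz x hx)).hasFDerivAt.continuousAt.continuousWithinAt
  have hxa : v x = a := hx.2
  have hxball : x ∈ ball z₀ η := by
    refine (mem_closedBall.1 hx.1).lt_of_ne fun h => ?_
    have := hx₁max (mem_sphere.2 h)
    simp only [mem_ofPred_eq] at this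
    linarith
  have hext : IsLocalExtrOn u {y | v y = v x} x := by
    refine Or.inr ?_
    filter_upwards [self_mem_nhdsWithin, nhdsWithin_le_nhds (isOpen_ball.mem_nhds hxball)]
      with y hy hyb
    exact hxmax ⟨ball_subset_closedBall hyb, hxa ▸ hy⟩
  obtain ⟨α, β, hne, h0⟩ := hext.exists_multipliers_of_hasStrictFDerivAt_1d
    (hv x (hsubρ hx.1) (hKz x hx)) (hu x (hsubρ hx.1) (hKz x hx))
  refine hne ?_
  obtain ⟨rfl, rfl⟩ := hind x (hsubρ hx.1) (hKz x hx) α β (by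
    apply (InnerProductSpace.toDual ℝ E2).injective
    simpa using h0)
  rfl

/-- Let `v` be nearly a solution of the eikonal equation around `z₀`, without local extremum at
`z₀`. Then the rotated gradient of `v` has winding number zero around `z₀`. The winding is
computed by extending the gradient inside the disc by symmetric difference quotients. -/
theorem angle_eq_of_almost_eikonal {v : E2 → ℝ} {G : E2 → E2} {z₀ : E2} {ρ c s : ℝ}
    (hc : ContinuousOn v (ball z₀ ρ)) (hρ : 0 < ρ)
    (hG : ∀ x ∈ ball z₀ ρ, x ≠ z₀ → HasGradientAt v (G x) x)
    (hcG : ∀ x ∈ ball z₀ ρ, x ≠ z₀ → c ≤ ‖G x‖) (hc0 : 0 < c)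
    (hLip : ∀ x ∈ ball z₀ ρ, ∀ y ∈ ball z₀ ρ, |v x - v y| ≤ 17 / 16 * c * ‖x - y‖)
    (hmax : ¬ IsLocalMax v z₀) (hmin : ¬ IsLocalMin v z₀) (hs : 0 < s)
    (hstrict : ∀ x ∈ ball z₀ ρ, x ≠ z₀ →
      HasStrictFDerivAt v (InnerProductSpace.toDual ℝ E2 (G x)) x)
    (hGc : ∀ x ∈ closedBall z₀ s, x ≠ z₀ → ContinuousAt G x)
    (hG0 : ∀ x ∈ closedBall z₀ s, x ≠ z₀ → G x ≠ 0)
    {θ m : ℝ → ℝ} (hθ : ContinuousOn θ (Icc 0 (2 * Real.pi)))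
    (hm : ∀ t ∈ Icc 0 (2 * Real.pi), 0 < m t)
    (h0 : ∀ t ∈ Icc 0 (2 * Real.pi), G (z₀ + s • eVec t) 0 = -(m t * Real.sin (θ t)))
    (h1 : ∀ t ∈ Icc 0 (2 * Real.pi), G (z₀ + s • eVec t) 1 = m t * Real.cos (θ t)) :
    θ (2 * Real.pi) = θ 0 := by
  set s₀ := min (ρ / 4) (s / 2) with hs₀
  have hs₀0 : 0 < s₀ := by positivity
  have hs₀ρ : s₀ ≤ ρ / 4 := min_le_left _ _
  have hs₀s : s₀ ≤ s / 2 := min_le_right _ _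
  set τ : E2 → ℝ := fun q => max 0 (s₀ - ‖q - z₀‖) with hτ
  have hτc : Continuous τ := by fun_prop
  have hτ0 : ∀ q, 0 ≤ τ q := fun q => le_max_left _ _
  have hτz : ∀ q, τ q = 0 → s₀ ≤ ‖q - z₀‖ := fun q hq => by
    have := le_max_right 0 (s₀ - ‖q - z₀‖)
    simp only [hτ] at hq
    linarith
  have hτne : ∀ q, τ q = 0 → q ≠ z₀ := by
    rintro q hq rfl
    have := hτz q hq
    simp at this
    linarith
  have hτpos : ∀ q, τ q ≠ 0 → 0 < τ q ∧ τ q = s₀ - ‖q - z₀‖ := fun q hq => by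
    have h2 := (hτ0 q).lt_of_ne' hq
    refine ⟨h2, max_eq_right ?_⟩
    by_contra! h3
    exact hq (max_eq_left h3.le)
  have hsub : ∀ q, τ q ≠ 0 → closedBall q (2 * τ q) ⊆ ball z₀ ρ := by
    intro q hq x hx
    obtain ⟨h2, h3⟩ := hτpos q hq
    rw [mem_closedBall, dist_eq_norm] at hx
    rw [mem_ball, dist_eq_norm]
    have : ‖x - z₀‖ ≤ ‖x - q‖ + ‖q - z₀‖ := by simpa using norm_add_le (x - q) (q - z₀)
    linarith [norm_nonneg (q - z₀)]
  set D : Fin 2 → E2 → ℝ := fun i q => if τ q = 0 then G q i else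
      (v (q + τ q • EuclideanSpace.single i 1) - v (q - τ q • EuclideanSpace.single i 1))
        / (2 * τ q) with hD
  have hDc : ∀ i, ContinuousOn (D i) (closedBall z₀ s) := by
    intro i q hq
    apply ContinuousAt.continuousWithinAt
    by_cases hq0 : τ q = 0
    · have hqz := hτne q hq0
      by_cases hqρ : q ∈ ball z₀ ρ
      · exact continuousAt_symm_diff_quotient (hstrict q hqρ hqz) (hGc q hq hqz)
          hτc.continuousAt hq0 i
      · have hGi : ContinuousAt (fun q => G q i) q := by
          have := hGc q hq hqz
          fun_prop
        refine hGi.congr ?_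
        have hlt : s₀ < ‖q - z₀‖ := by
          rw [mem_ball, dist_eq_norm] at hqρ
          linarith
        have hcn : Continuous fun x : E2 => ‖x - z₀‖ := by fun_prop
        filter_upwards [(isOpen_lt continuous_const hcn).mem_nhds hlt] with x hx
        have hx : s₀ < ‖x - z₀‖ := hx
        have : τ x = 0 := max_eq_left (by linarith)
        simp [hD, this]
    · have hb1 : q + τ q • EuclideanSpace.single i 1 ∈ ball z₀ ρ := by
        refine hsub q hq0 ?_
        simp [norm_smul, abs_of_nonneg (hτ0 q)]
        linarith [hτ0 q]
      have hb2 : q - τ q • EuclideanSpace.single i 1 ∈ ball z₀ ρ := by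
        refine hsub q hq0 ?_
        simp [norm_smul, abs_of_nonneg (hτ0 q)]
        linarith [hτ0 q]
      have hv1 : ContinuousAt (fun q => v (q + τ q • EuclideanSpace.single i 1)) q :=
        ContinuousAt.comp (g := v) (f := fun q => q + τ q • EuclideanSpace.single i 1)
          (hc.continuousAt (isOpen_ball.mem_nhds hb1)) (by fun_prop)
      have hv2 : ContinuousAt (fun q => v (q - τ q • EuclideanSpace.single i 1)) q :=
        ContinuousAt.comp (g := v) (f := fun q => q - τ q • EuclideanSpace.single i 1)
          (hc.continuousAt (isOpen_ball.mem_nhds hb2)) (by fun_prop)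
      have : ContinuousAt (fun q => (v (q + τ q • EuclideanSpace.single i 1)
          - v (q - τ q • EuclideanSpace.single i 1)) / (2 * τ q)) q :=
        (hv1.sub hv2).div (by fun_prop) (by simpa using hq0)
      refine this.congr ?_
      filter_upwards [(isOpen_ne_fun hτc continuous_const).mem_nhds hq0] with x hx
      have hx : τ x ≠ 0 := hx
      simp [hD, hx]
  have hne : ∀ q ∈ closedBall z₀ s, ¬ ∀ i, D i q = 0 := by
    intro q hq hall
    by_cases hq0 : τ q = 0
    · refine hG0 q hq (hτne q hq0) ?_
      ext i
      simpa [hD, hq0] using hall i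
    · obtain ⟨h2, -⟩ := hτpos q hq0
      refine not_forall_symm_diff_eq_zero hc hρ hG hcG hc0 hLip hmax hmin h2 (hsub q hq0)
        fun i => ?_
      have h3 := hall i
      simp only [hD, hq0, if_false] at h3
      exact (div_eq_zero_iff.1 h3).resolve_right (by positivity)
  have hτs : ∀ t, τ (z₀ + s • eVec t) = 0 := by
    intro t
    simp only [hτ, add_sub_cancel_left, norm_smul, norm_eVec, Real.norm_eq_abs, abs_of_pos hs]
    exact max_eq_left (by linarith)
  refine angle_eq_of_continuousOn_closedBall (z₀ := z₀)
    (P := fun q => (D 1 q : ℂ) - D 0 q * Complex.I) hs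
    ?_ ?_ hθ hm ?_
  · exact (Complex.continuous_ofReal.comp_continuousOn (hDc 1)).sub
      ((Complex.continuous_ofReal.comp_continuousOn (hDc 0)).mul continuousOn_const)
  · intro q hq h
    apply hne q hq
    have hre := congrArg Complex.re h
    have him := congrArg Complex.im h
    simp at hre him
    intro i
    fin_cases i
    · exact him
    · exact hre
  · intro t ht
    simp only [hD, hτs, if_true, h0 t ht, h1 t ht]
    rw [Complex.exp_mul_I]
    push_cast
    ring

/-- The derivative of the convolution of a `1`-form with a smooth compactly supported scalar
kernel. -/
theorem hasFDerivAt_convolution_smul {W : E2 → E2 →L[ℝ] ℝ} (hW : LocallyIntegrable W)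
    {η : E2 → ℝ} (hηs : ContDiff ℝ 1 η) (hηc : HasCompactSupport η) (x : E2) :
    ∃ D : E2 →L[ℝ] E2 →L[ℝ] ℝ,
      HasFDerivAt (convolution η W (ContinuousLinearMap.lsmul ℝ ℝ) volume) D x ∧
      ∀ a c, Integrable (fun y => fderiv ℝ η (x - y) a * W y c) ∧
        D a c = ∫ y, fderiv ℝ η (x - y) a * W y c := by
  let L : (E2 →L[ℝ] ℝ) →L[ℝ] ℝ →L[ℝ] (E2 →L[ℝ] ℝ) := (ContinuousLinearMap.lsmul ℝ ℝ).flip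
  have hWint : ∀ a, Integrable fun y => fderiv ℝ η (x - y) a • W y := by
    intro a
    have h1 : HasCompactSupport fun y => fderiv ℝ η y a :=
      (hηc.fderiv (𝕜 := ℝ)).comp_left (g := fun l : E2 →L[ℝ] ℝ => l a) (by simp)
    have h2 : Continuous fun y => fderiv ℝ η y a :=
      (hηs.continuous_fderiv one_ne_zero).clm_apply continuous_const
    exact h1.convolutionExists_right L hW h2 x
  have hder := hηc.hasFDerivAt_convolution_right L hW hηs x
  rw [← convolution_flip] at hder
  refine ⟨_, hder, fun a c => ⟨(ContinuousLinearMap.apply ℝ ℝ c).integrable_comp (hWint a), ?_⟩⟩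
  rw [convolution_precompR_apply L hW (hηc.fderiv (𝕜 := ℝ))
    (hηs.continuous_fderiv one_ne_zero), convolution_def]
  exact ContinuousLinearMap.integral_apply (hWint a) c

/-- A weakly closed, locally integrable `1`-form becomes exact on a smaller ball after
mollification at scale `ε`. -/
theorem exists_mollified_primitive {W : E2 → E2 →L[ℝ] ℝ} (hW : LocallyIntegrable W) {z₀ : E2}
    {ρ ε : ℝ} (hε : 0 < ε) (hερ : ε < ρ)
    (hclosed : ∀ φ : E2 → ℝ, ContDiff ℝ (⊤ : ℕ∞) φ → HasCompactSupport φ →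
      tsupport φ ⊆ ball z₀ (2 * ρ) → ∀ a b : E2,
        ∫ y, (fderiv ℝ φ y a * W y b - fderiv ℝ φ y b * W y a) = 0) :
    ∃ (H : E2 → E2 →L[ℝ] ℝ) (v : E2 → ℝ), v z₀ = 0 ∧ Continuous H ∧
      (∀ x ∈ ball z₀ ρ, HasFDerivAt v (H x) x) ∧
      ∀ x w δ, 0 ≤ δ → (∀ y ∈ ball x ε, dist (W y) w ≤ δ) → dist (H x) w ≤ δ := by
  obtain ⟨b, hb⟩ : ∃ b : ContDiffBump (0 : E2), b.rOut = ε :=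
    ⟨⟨ε / 2, ε, by positivity, by linarith⟩, rfl⟩
  obtain ⟨η, hη⟩ : ∃ η, η = b.normed (volume : Measure E2) := ⟨_, rfl⟩
  have hηs : ContDiff ℝ (⊤ : ℕ∞) η := hη ▸ b.contDiff_normed
  have hηc : HasCompactSupport η := hη ▸ b.hasCompactSupport_normed
  have hηt : tsupport η = closedBall 0 ε := by rw [hη, ← hb, b.tsupport_normed_eq]
  have hη1 : ContDiff ℝ 1 η := hηs.of_le (by exact_mod_cast le_top)
  have hHW : ∀ x w δ, 0 ≤ δ → (∀ y ∈ ball x ε, dist (W y) w ≤ δ) →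
      dist (convolution η W (ContinuousLinearMap.lsmul ℝ ℝ) volume x) w ≤ δ := by
    intro x w δ hδ h
    rw [hη]
    exact dist_convolution_le hδ (hb ▸ b.support_normed_eq.subset) b.nonneg_normed
      b.integral_normed hW.aestronglyMeasurable h
  choose D hD hDint using hasFDerivAt_convolution_smul hW hη1 hηc
  generalize convolution η W (ContinuousLinearMap.lsmul ℝ ℝ) volume = H at hD hHW
  have hdiff : Differentiable ℝ H := fun x => (hD x).differentiableAt
  have hsymm : ∀ x ∈ ball z₀ ρ, ∀ a c, fderiv ℝ H x a c = fderiv ℝ H x c a := by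
    intro x hx a c
    rw [(hD x).fderiv, (hDint x a c).2, (hDint x c a).2, ← sub_eq_zero,
      ← integral_sub (hDint x a c).1 (hDint x c a).1]
    have hsubl : ContDiff ℝ (⊤ : ℕ∞) fun y : E2 => x - y := by fun_prop
    have hsupp : tsupport (fun y => η (x - y)) ⊆ closedBall x ε := by
      refine closure_minimal (fun y hy => ?_) isClosed_closedBall
      have : x - y ∈ tsupport η := subset_tsupport _ hy
      rw [hηt] at this
      simpa [dist_eq_norm, norm_sub_rev] using this
    have := hclosed (fun y => η (x - y)) (hηs.comp hsubl)
      (HasCompactSupport.of_support_subset_isCompact (isCompact_closedBall x ε)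
        ((subset_tsupport _).trans hsupp))
      (hsupp.trans (closedBall_subset_ball' (by rw [mem_ball] at hx; linarith))) a c
    have hφ : ∀ y e, fderiv ℝ (fun y => η (x - y)) y e = -fderiv ℝ η (x - y) e := by
      intro y e
      have h3 : HasFDerivAt (fun y => x - y) (-ContinuousLinearMap.id ℝ E2) y := by
        simpa using (hasFDerivAt_id y).const_sub x
      have h5 := (((hη1.differentiable one_ne_zero (x - y)).hasFDerivAt).comp y h3).fderiv
      simp only [Function.comp_def] at h5
      rw [h5]
      simp
    simp only [hφ] at this
    rw [← neg_eq_zero, ← integral_neg, ← this]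
    congr 1
    ext y
    ring
  obtain ⟨v, hv⟩ := (convex_ball z₀ ρ).exists_forall_hasFDerivAt_of_fderiv_symmetric isOpen_ball
    hdiff.differentiableOn hsymm
  exact ⟨H, fun x => v x - v z₀, sub_self _, hdiff.continuous,
    fun x hx => (hv x hx).sub_const _, hHW⟩

/-- A bounded weakly closed `1`-form, continuous on a punctured ball, has a Lipschitz primitive
there. -/
theorem exists_lipschitz_primitive {W : E2 → E2 →L[ℝ] ℝ} (hWm : AEStronglyMeasurable W volume)
    {M : ℝ} (hM : ∀ x, ‖W x‖ ≤ M) {z₀ : E2} {ρ : ℝ} (hρ : 0 < ρ)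
    (hWc : ∀ x ∈ ball z₀ ρ, x ≠ z₀ → ContinuousAt W x)
    (hclosed : ∀ φ : E2 → ℝ, ContDiff ℝ (⊤ : ℕ∞) φ → HasCompactSupport φ →
      tsupport φ ⊆ ball z₀ (2 * ρ) → ∀ a b : E2,
        ∫ y, (fderiv ℝ φ y a * W y b - fderiv ℝ φ y b * W y a) = 0) :
    ∃ v : E2 → ℝ, (∀ x ∈ ball z₀ ρ, ∀ y ∈ ball z₀ ρ, |v x - v y| ≤ M * ‖x - y‖) ∧
      ∀ x ∈ ball z₀ ρ, x ≠ z₀ → HasFDerivAt v (W x) x := by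
  have hM0 : 0 ≤ M := (norm_nonneg _).trans (hM z₀)
  have hWi : LocallyIntegrable W :=
    (locallyIntegrable_const M).mono hWm (Eventually.of_forall fun x => by
      simpa [abs_of_nonneg hM0] using hM x)
  set ε : ℕ → ℝ := fun n => ρ / (n + 2) with hεdef
  have hε : ∀ n, 0 < ε n := fun n => by positivity
  have hερ : ∀ n, ε n < ρ := fun n => div_lt_self hρ (by linarith [n.cast_nonneg (α := ℝ)])
  have hε0 : Tendsto ε atTop (𝓝 0) := by
    refine tendsto_const_nhds.div_atTop (tendsto_atTop_add_const_right _ _ ?_)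
    exact tendsto_natCast_atTop_atTop
  choose H v hv0 hHc hvd hHW using fun n =>
    exists_mollified_primitive hWi (hε n) (hερ n) hclosed
  have hHM : ∀ n x, ‖H n x‖ ≤ M := fun n x => by
    simpa using hHW n x 0 M hM0 fun y _ => by simpa using hM y
  have hloc : ∀ x ∈ ball z₀ ρ, x ≠ z₀ → TendstoUniformlyOnFilter H W atTop (𝓝 x) := by
    intro x hx hxz
    rw [Metric.tendstoUniformlyOnFilter_iff]
    intro e he
    obtain ⟨d, hd, hdW⟩ := Metric.continuousAt_iff.1 (hWc x hx hxz) (e / 3) (by positivity)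
    have h1 : ∀ᶠ n in atTop, ε n < d / 2 := hε0.eventually_lt_const (by positivity)
    filter_upwards [h1.prod_mk (ball_mem_nhds x (half_pos hd))] with p hp
    obtain ⟨hp1, hp2⟩ := hp
    have h2 : dist (H p.1 p.2) (W x) ≤ e / 3 := by
      refine hHW _ _ _ _ (by positivity) fun y hy => (hdW ?_).le
      rw [mem_ball] at hy
      linarith [dist_triangle y p.2 x]
    have h3 : dist (W p.2) (W x) < e / 3 := hdW (by linarith)
    linarith [dist_triangle_right (W p.2) (H p.1 p.2) (W x)]
  have hlim : ∀ x ∈ ball z₀ ρ, ∃ l, Tendsto (fun n => v n x) atTop (𝓝 l) := by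
    intro x hx
    have hseg : ∀ t ∈ Icc (0 : ℝ) 1, z₀ + t • (x - z₀) ∈ ball z₀ ρ := by
      intro t ht
      rw [mem_ball, dist_eq_norm] at hx
      rw [mem_ball, dist_eq_norm, add_sub_cancel_left, norm_smul, Real.norm_eq_abs,
        abs_of_nonneg ht.1]
      nlinarith [ht.2, norm_nonneg (x - z₀)]
    have hγ : Continuous fun t : ℝ => z₀ + t • (x - z₀) := by fun_prop
    have heq : ∀ n, v n x = ∫ t in (0 : ℝ)..1, H n (z₀ + t • (x - z₀)) (x - z₀) := by
      intro n
      have hWint : IntervalIntegrable (fun t : ℝ => H n (z₀ + t • (x - z₀)) (x - z₀)) volume 0 1 :=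
        (((hHc n).comp hγ).clm_apply continuous_const).intervalIntegrable _ _
      rw [intervalIntegral.integral_eq_sub_of_hasDerivAt
        (f := fun t : ℝ => v n (z₀ + t • (x - z₀))) (fun t ht => ?_) hWint]
      · simp [hv0]
      · rw [uIcc_of_le zero_le_one] at ht
        have h1 : HasDerivAt (fun t : ℝ => z₀ + t • (x - z₀)) (x - z₀) t := by
          simpa using ((hasDerivAt_id t).smul_const (x - z₀)).const_add z₀
        exact (hvd n _ (hseg t ht)).comp_hasDerivAt t h1
    by_cases hxz : x = z₀
    · exact ⟨0, by simp [hxz, hv0]⟩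
    refine ⟨∫ t in (0 : ℝ)..1, W (z₀ + t • (x - z₀)) (x - z₀), ?_⟩
    simp only [heq]
    refine intervalIntegral.tendsto_integral_filter_of_dominated_convergence
      (fun _ => M * ‖x - z₀‖) ?_ ?_ intervalIntegrable_const ?_
    · exact Eventually.of_forall fun n =>
        (((hHc n).comp hγ).clm_apply continuous_const).aestronglyMeasurable
    · exact Eventually.of_forall fun n => Eventually.of_forall fun t _ =>
        (H n _).le_of_opNorm_le (hHM n _) _
    · refine Eventually.of_forall fun t ht => ?_
      rw [uIoc_of_le zero_le_one] at ht
      have h1 := (hloc _ (hseg t ⟨ht.1.le, ht.2⟩) (by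
        simp [ht.1.ne', sub_eq_zero, hxz])).tendsto_at (by rw [principal_singleton]; exact pure_le_nhds _)
      exact (ContinuousLinearMap.apply ℝ ℝ (x - z₀)).continuous.continuousAt.tendsto.comp h1
  choose! g hg using hlim
  refine ⟨g, fun x hx y hy => ?_, fun x hx hxz => ?_⟩
  · refine le_of_tendsto ((hg x hx).sub (hg y hy)).abs (Eventually.of_forall fun n => ?_)
    exact (convex_ball z₀ ρ).norm_image_sub_le_of_norm_hasFDerivWithin_le
      (fun z hz => (hvd n z hz).hasFDerivWithinAt) (fun z _ => hHM n z) hy hx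
  · have hb := isOpen_ball.mem_nhds hx
    refine hasFDerivAt_of_tendstoUniformlyOnFilter (hloc x hx hxz) ?_ (eventually_of_mem hb hg)
    filter_upwards [Eventually.prod_inr hb atTop] with p hp
    exact hvd p.1 p.2 hp

/-- Rotation by a right angle in the plane. -/
def quarterTurn : E2 →L[ℝ] E2 :=
  LinearMap.toContinuousLinearMap
    { toFun := fun w => !₂[-w 1, w 0]
      map_add' := fun v w => by ext i; fin_cases i <;> simp [add_comm]
      map_smul' := fun a w => by ext i; fin_cases i <;> simp }

theorem quarterTurn_apply_zero (w : E2) : quarterTurn w 0 = -w 1 := rfl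

theorem quarterTurn_apply_one (w : E2) : quarterTurn w 1 = w 0 := rfl

theorem norm_quarterTurn (w : E2) : ‖quarterTurn w‖ = ‖w‖ := by
  simp [EuclideanSpace.norm_eq, quarterTurn_apply_zero, quarterTurn_apply_one, add_comm]

/-- A field and its rotated multiple are linearly independent. -/
theorem eq_zero_of_smul_quarterTurn_add_smul {p : E2} (hp : p ≠ 0) {α β : ℝ}
    (h : α • quarterTurn p + β • p = 0) : α = 0 ∧ β = 0 := by
  have h0 := congrArg (fun w : E2 => w 0) h
  have h1 := congrArg (fun w : E2 => w 1) h
  simp [quarterTurn_apply_zero, quarterTurn_apply_one] at h0 h1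
  have hpp : p 0 ^ 2 + p 1 ^ 2 ≠ 0 := by
    have h2 := EuclideanSpace.norm_sq_eq p
    simp at h2
    rw [← h2]
    positivity
  constructor
  · refine (mul_eq_zero.1 (?_ : α * (p 0 ^ 2 + p 1 ^ 2) = 0)).resolve_right hpp
    linear_combination (-p 1) * h0 + p 0 * h1
  · refine (mul_eq_zero.1 (?_ : β * (p 0 ^ 2 + p 1 ^ 2) = 0)).resolve_right hpp
    linear_combination p 0 * h0 + p 1 * h1

/-- A bounded, weakly divergence free field, continuous on a punctured ball, has a Lipschitz
stream function on a smaller ball. -/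
theorem exists_stream_function {F : E2 → E2} {z₀ : E2} {ρ M : ℝ} (hρ : 0 < ρ) (hM0 : 0 ≤ M)
    (hF : ∀ x ∈ ball z₀ (2 * ρ), x ≠ z₀ → ContinuousAt F x)
    (hM : ∀ x ∈ ball z₀ (2 * ρ), x ≠ z₀ → ‖F x‖ ≤ M)
    (hdiv : ∀ φ : E2 → ℝ, ContDiff ℝ (⊤ : ℕ∞) φ → HasCompactSupport φ →
      tsupport φ ⊆ ball z₀ (2 * ρ) → ∫ y in ball z₀ (2 * ρ) \ {z₀}, ⟪F y, gradient φ y⟫ = 0) :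
    ∃ v : E2 → ℝ, (∀ x ∈ ball z₀ ρ, ∀ y ∈ ball z₀ ρ, |v x - v y| ≤ M * ‖x - y‖) ∧
      ∀ x ∈ ball z₀ ρ, x ≠ z₀ → HasGradientAt v (quarterTurn (F x)) x := by
  set S : Set E2 := ball z₀ (2 * ρ) \ {z₀} with hS
  have hSo : IsOpen S := isOpen_ball.sdiff isClosed_singleton
  set T : E2 → E2 →L[ℝ] ℝ := fun y => InnerProductSpace.toDual ℝ E2 (quarterTurn (F y)) with hT
  have hTc : ∀ x ∈ S, ContinuousAt T x := fun x hx =>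
    (InnerProductSpace.toDual ℝ E2).continuous.continuousAt.comp
      (quarterTurn.continuous.continuousAt.comp (hF x hx.1 hx.2))
  have hTS : ∀ x ∈ S, S.indicator T =ᶠ[𝓝 x] T := fun x hx => by
    filter_upwards [hSo.mem_nhds hx] with y hy using indicator_of_mem hy T
  have hsub : ∀ x ∈ ball z₀ ρ, x ≠ z₀ → x ∈ S := fun x hx hxz =>
    ⟨ball_subset_ball (by linarith) hx, hxz⟩
  have hTM : ∀ x, ‖S.indicator T x‖ ≤ M := by
    intro x
    by_cases hx : x ∈ S
    · rw [indicator_of_mem hx, hT, LinearIsometryEquiv.norm_map, norm_quarterTurn]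
      exact hM x hx.1 hx.2
    · rwa [indicator_of_notMem hx, norm_zero]
  have hclosed : ∀ φ : E2 → ℝ, ContDiff ℝ (⊤ : ℕ∞) φ → HasCompactSupport φ →
      tsupport φ ⊆ ball z₀ (2 * ρ) → ∀ a b : E2,
        ∫ y, (fderiv ℝ φ y a * S.indicator T y b - fderiv ℝ φ y b * S.indicator T y a) = 0 := by
    intro φ hφ hφc hφs a b
    have h1 := congrArg (fun z => (a 0 * b 1 - a 1 * b 0) * z) (hdiv φ hφ hφc hφs)
    simp only [mul_zero] at h1
    rw [← integral_const_mul, ← integral_indicator hSo.measurableSet] at h1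
    rw [← h1]
    congr 1
    ext y
    by_cases hy : y ∈ S
    · rw [indicator_of_mem hy, indicator_of_mem hy]
      have hg : ∀ e, fderiv ℝ φ y e = ⟪gradient φ y, e⟫ := fun e => by simp [gradient]
      rw [hg, hg]
      simp only [hT, InnerProductSpace.toDual_apply_apply, PiLp.inner_apply, Fin.sum_univ_two,
        quarterTurn_apply_zero, quarterTurn_apply_one, RCLike.inner_apply, conj_trivial]
      ring
    · simp [indicator_of_notMem hy]
  obtain ⟨v, hv1, hv2⟩ := exists_lipschitz_primitive
    ((aestronglyMeasurable_indicator_iff hSo.measurableSet).2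
      (ContinuousOn.aestronglyMeasurable (fun x hx => (hTc x hx).continuousWithinAt)
        hSo.measurableSet)) hTM hρ
    (fun x hx hxz => (hTc x (hsub x hx hxz)).congr (hTS x (hsub x hx hxz)).symm) hclosed
  refine ⟨v, hv1, fun x hx hxz => ?_⟩
  have := hv2 x hx hxz
  rwa [indicator_of_mem (hsub x hx hxz)] at this

theorem StdF.continuousOn_dtop {f : ℝ → ℝ} (hf : StdF f) : ContinuousOn (dtop f) (Ici 0) :=
  hf.2.1.continuousOn_derivWithin (uniqueDiffOn_Ici 0) le_rfl

theorem StdF.dtop_zero_le {f : ℝ → ℝ} (hf : StdF f) {t : ℝ} (ht : 0 ≤ t) :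
    dtop f 0 ≤ dtop f t :=
  hf.1.convexOn.monotoneOn_derivWithin (hf.2.1.differentiableOn one_ne_zero)
    self_mem_Ici ht ht

/-- The index of an isolated critical point `z₀` of a `C¹` weak solution of
`div(f'(‖∇u‖)∇u/‖∇u‖) = 0` is zero: every continuous angular lift `θ` of the unit gradient
field along a circle of radius `s ≤ r` around `z₀` satisfies `θ(2π) = θ(0)`. -/
theorem index_of_isolated_critical_point_is_zero
    (f : ℝ → ℝ) (hf : StdF f)
    (Ω : Set E2) (hΩo : IsOpen Ω)
    (u : E2 → ℝ) (huC1 : ContDiffOn ℝ 1 u Ω) (hu : WeakSol (dtop f) Ω u)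
    (z₀ : E2) (r : ℝ) (hr : 0 < r) (hball : closedBall z₀ r ⊆ Ω)
    (hz₀ : gradient u z₀ = 0)
    (hiso : ∀ z ∈ closedBall z₀ r, z ≠ z₀ → gradient u z ≠ 0) :
    ∀ s : ℝ, 0 < s → s ≤ r → ∀ θ : ℝ → ℝ,
      ContinuousOn θ (Icc 0 (2 * Real.pi)) →
      (∀ t ∈ Icc (0:ℝ) (2 * Real.pi),
        (‖gradient u (z₀ + s • eVec t)‖)⁻¹ • gradient u (z₀ + s • eVec t) = eVec (θ t)) →
      θ (2 * Real.pi) = θ 0 := by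
  intro s hs hsr θ hθ hθu
  have hz₀Ω : z₀ ∈ Ω := hball (mem_closedBall_self hr.le)
  set c := dtop f 0 with hc
  have hc0 : 0 < c := hf.2.2.2.2
  have hdpos : ∀ w : E2, c ≤ dtop f ‖w‖ := fun w => hf.dtop_zero_le (norm_nonneg w)
  have hAc : ∀ x ∈ Ω, ContinuousAt (gradient u) x := fun x hx =>
    (InnerProductSpace.toDual ℝ E2).symm.continuous.continuousAt.comp
      ((huC1.continuousOn_fderiv_of_isOpen hΩo le_rfl).continuousAt (hΩo.mem_nhds hx))
  set F : E2 → E2 := fun x => dtop f ‖gradient u x‖ • (‖gradient u x‖)⁻¹ • gradient u x with hF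
  have hFn : ∀ x, gradient u x ≠ 0 → ‖F x‖ = dtop f ‖gradient u x‖ := by
    intro x hx
    have h1 : 0 < dtop f ‖gradient u x‖ := hc0.trans_le (hdpos _)
    rw [hF, norm_smul, norm_smul, norm_inv, norm_norm, inv_mul_cancel₀ (norm_ne_zero_iff.2 hx),
      mul_one, Real.norm_eq_abs, abs_of_pos h1]
  have hFc : ∀ x ∈ closedBall z₀ r, x ≠ z₀ → ContinuousAt F x := by
    intro x hx hxz
    have h1 := norm_pos_iff.2 (hiso x hx hxz)
    have h2 := hAc x (hball hx)
    have h3 : ContinuousAt (dtop f) ‖gradient u x‖ :=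
      hf.continuousOn_dtop.continuousAt (Ici_mem_nhds h1)
    exact (ContinuousAt.comp (f := fun x => ‖gradient u x‖) h3 h2.norm).smul
      ((h2.norm.inv₀ h1.ne').smul h2)
  obtain ⟨ρ, hρ, hρr, hρM⟩ : ∃ ρ > 0, 2 * ρ ≤ r ∧
      ∀ x ∈ ball z₀ (2 * ρ), dtop f ‖gradient u x‖ ≤ 17 / 16 * c := by
    have h1 : ContinuousAt (fun x => dtop f ‖gradient u x‖) z₀ := by
      have h2 : Tendsto (fun x => ‖gradient u x‖) (𝓝 z₀) (𝓝[Ici 0] 0) := by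
        refine tendsto_nhdsWithin_iff.2
          ⟨?_, Eventually.of_forall fun x => norm_nonneg (gradient u x)⟩
        simpa [ContinuousAt, hz₀] using (hAc z₀ hz₀Ω).norm
      have h3 : Tendsto (dtop f) (𝓝[Ici 0] 0) (𝓝 (dtop f 0)) :=
        hf.continuousOn_dtop 0 self_mem_Ici
      have h4 := h3.comp h2
      simpa [ContinuousAt, hz₀, Function.comp_def] using h4
    have h5 : dtop f ‖gradient u z₀‖ < 17 / 16 * c := by
      rw [hz₀, norm_zero]
      linarith
    obtain ⟨δ, hδ, hδM⟩ := Metric.eventually_nhds_iff_ball.1 (h1.eventually_lt_const h5)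
    refine ⟨min δ r / 2, by positivity, by linarith [min_le_right δ r], fun x hx => ?_⟩
    exact (hδM x (ball_subset_ball (by linarith [min_le_left δ r]) hx)).le
  have hsub2 : ball z₀ (2 * ρ) ⊆ closedBall z₀ r :=
    (ball_subset_ball hρr).trans ball_subset_closedBall
  have hsub1 : ball z₀ ρ ⊆ closedBall z₀ r := (ball_subset_ball (by linarith)).trans hsub2
  have hdiv : ∀ φ : E2 → ℝ, ContDiff ℝ (⊤ : ℕ∞) φ → HasCompactSupport φ →
      tsupport φ ⊆ ball z₀ (2 * ρ) →
      ∫ y in ball z₀ (2 * ρ) \ {z₀}, ⟪F y, gradient φ y⟫ = 0 := by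
    intro φ hφ hφc hφs
    rw [← hu φ hφ hφc (hφs.trans (hsub2.trans hball)), eq_comm]
    have heq : ∀ y, (if gradient u y = 0 then 0 else
        dtop f ‖gradient u y‖ * ⟪(‖gradient u y‖)⁻¹ • gradient u y, gradient φ y⟫) =
        ⟪F y, gradient φ y⟫ := by
      intro y
      split_ifs with h
      · simp [hF, h]
      · simp only [hF, real_inner_smul_left]
    simp only [heq]
    refine setIntegral_eq_of_subset_of_forall_sdiff_eq_zero hΩo.measurableSet
      (sdiff_subset.trans (hsub2.trans hball)) fun x hx => ?_
    by_cases hxz : x = z₀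
    · simp [hF, hxz, hz₀]
    · have : x ∉ tsupport φ := fun h => hx.2 ⟨hφs h, hxz⟩
      simp [gradient, fderiv_of_notMem_tsupport ℝ this]
  obtain ⟨v, hvLip, hvG⟩ := exists_stream_function (M := 17 / 16 * c) hρ (by positivity)
    (fun x hx => hFc x (hsub2 hx))
    (fun x hx hxz => (hFn x (hiso x (hsub2 hx) hxz)).trans_le (hρM x hx)) hdiv
  have hvc : ContinuousOn v (ball z₀ ρ) :=
    (LipschitzOnWith.of_dist_le_mul (K := (17 / 16 * c).toNNReal) fun x hx y hy => by
      rw [Real.coe_toNNReal _ (by positivity), Real.dist_eq, dist_eq_norm]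
      exact hvLip x hx y hy).continuousOn
  have hGc : ∀ x ∈ closedBall z₀ r, x ≠ z₀ → ContinuousAt (fun x => quarterTurn (F x)) x :=
    fun x hx hxz => quarterTurn.continuous.continuousAt.comp (hFc x hx hxz)
  have hstrict : ∀ x ∈ ball z₀ ρ, x ≠ z₀ →
      HasStrictFDerivAt v (InnerProductSpace.toDual ℝ E2 (quarterTurn (F x))) x := by
    intro x hx hxz
    refine hasStrictFDerivAt_of_hasFDerivAt_of_continuousAt
      (f' := fun x => InnerProductSpace.toDual ℝ E2 (quarterTurn (F x))) ?_
      ((InnerProductSpace.toDual ℝ E2).continuous.continuousAt.comp (hGc x (hsub1 hx) hxz))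
    filter_upwards [(isOpen_ball.sdiff isClosed_singleton).mem_nhds ⟨hx, hxz⟩] with y hy
    exact hvG y hy.1 hy.2
  have hustrict : ∀ x ∈ ball z₀ ρ, x ≠ z₀ →
      HasStrictFDerivAt u (InnerProductSpace.toDual ℝ E2 (gradient u x)) x := by
    intro x hx _
    have h1 := (huC1.contDiffAt (hΩo.mem_nhds (hball (hsub1 hx)))).hasStrictFDerivAt one_ne_zero
    simpa [gradient] using h1
  have hind : ∀ x ∈ ball z₀ ρ, x ≠ z₀ → ∀ α β : ℝ,
      α • quarterTurn (F x) + β • gradient u x = 0 → α = 0 ∧ β = 0 := by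
    intro x hx hxz α β h
    have hA := hiso x (hsub1 hx) hxz
    set k := dtop f ‖gradient u x‖ * (‖gradient u x‖)⁻¹ with hk
    have hk0 : k ≠ 0 :=
      mul_ne_zero (hc0.trans_le (hdpos _)).ne' (inv_ne_zero (norm_ne_zero_iff.2 hA))
    have hFk : F x = k • gradient u x := by rw [hF, hk, mul_smul]
    rw [hFk, map_smul, smul_smul] at h
    obtain ⟨h1, h2⟩ := eq_zero_of_smul_quarterTurn_add_smul hA h
    exact ⟨(mul_eq_zero.1 h1).resolve_right hk0, h2⟩
  have hmax : ¬ IsLocalMax v z₀ :=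
    not_isLocalMax_of_independent_gradients hρ hvc hustrict hstrict hind
  have hmin : ¬ IsLocalMin v z₀ := fun h =>
    not_isLocalMax_of_independent_gradients (v := fun x => -v x)
      (G := fun x => -quarterTurn (F x)) hρ hvc.neg hustrict
      (fun x hx hxz => by simpa using (hstrict x hx hxz).fun_neg)
      (fun x hx hxz α β h' => by
        obtain ⟨h1, h2⟩ := hind x hx hxz (-α) β (by simpa using h')
        exact ⟨neg_eq_zero.1 h1, h2⟩) h.neg
  have hsubs : closedBall z₀ s ⊆ closedBall z₀ r := closedBall_subset_closedBall hsr
  have hFne : ∀ x ∈ closedBall z₀ r, x ≠ z₀ → c ≤ ‖quarterTurn (F x)‖ := fun x hx hxz => by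
    rw [norm_quarterTurn, hFn x (hiso x hx hxz)]
    exact hdpos _
  refine angle_eq_of_almost_eikonal (m := fun t => dtop f ‖gradient u (z₀ + s • eVec t)‖)
    hvc hρ hvG (fun x hx => hFne x (hsub1 hx)) hc0 hvLip hmax hmin hs hstrict
    (fun x hx => hGc x (hsubs hx)) (fun x hx hxz => ?_) hθ
    (fun t _ => hc0.trans_le (hdpos _)) (fun t ht => ?_) (fun t ht => ?_)
  · exact norm_pos_iff.1 (hc0.trans_le (hFne x (hsubs hx) hxz))
  · simp [quarterTurn_apply_zero, hF, hθu t ht, eVec_apply_one]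
  · simp [quarterTurn_apply_one, hF, hθu t ht, eVec_apply_zero]
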